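/- Let s ≥ 1 and t ≥ 1 be integers. There is a constant C (depending only on s) with the following property. Let G be a graph with s-degree partition {V_1, …, V_t}, let F be a layered subgraph with boundary b and let v_m, …, v_1 be an ordering of V(F) embedded in {V_1, …, V_b}. Let α be an (s+2)-coloring of G, let h ∈ {1, …, b} be the smallest index such that V_h contains a vertex colored s+2 under α, let W be the set of vertices of V_h colored s+2, and for a color a ∈ {1, …, s+1} let W_a = { v_i ∈ W : α(v_j) ≠ a for all neighbors v_j of v_i with j > i }. Set U = V_1 ∪ ⋯ ∪ V_{h−1}. Then for each a ∈ {1, …, s+1} there is a sequence of single-vertex recolorings in R_{s+2}(G) starting from α such that: each vertex of U is recolored at most C · (2t)^{s−1} times; each vertex of W_a is recolored at most once; no vertex of V(G) ∖ (U ∪ W_a) is recolored; and in the final coloring no vertex of U ∪ W_a has color s+2. -/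

import Mathlib

/-- A proper `k`-coloring of a simple graph. -/
def ProperColoring {V : Type} (G : SimpleGraph V) (k : ℕ) (f : V → Fin k) : Prop :=
  ∀ ⦃u v : V⦄, G.Adj u v → f u ≠ f v

/-- Two colorings differ in the color of exactly one vertex. -/
def DiffersAtExactlyOne {V : Type} {k : ℕ} (f g : V → Fin k) : Prop :=
  ∃! v : V, f v ≠ g v

/-- A walk of length `m` in the reconfiguration graph `R_k(G)`. -/
def RecoloringSeq {V : Type} (G : SimpleGraph V) (k m : ℕ) (c : ℕ → V → Fin k) : Prop :=
  (∀ i ≤ m, ProperColoring G k (c i)) ∧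
  (∀ i < m, DiffersAtExactlyOne (c i) (c (i + 1)))

/-- Number of times vertex `v` is recolored during the first `m` steps of `c`. -/
def recolorCount {V : Type} {k : ℕ} (c : ℕ → V → Fin k) (m : ℕ) (v : V) : ℕ :=
  ((Finset.range m).filter (fun i => c i v ≠ c (i + 1) v)).card

/-- `P` is an `s`-degree partition of `G` into `t` parts. -/
def IsDegreePartition {V : Type} (G : SimpleGraph V) (s t : ℕ) (P : Fin t → Set V) : Prop :=
  (∀ v : V, ∃! i : Fin t, v ∈ P i) ∧
  (∀ i : Fin t, ∀ u ∈ P i, ∀ v ∈ P i, ¬ G.Adj u v) ∧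
  (∀ i : Fin t, ∀ v ∈ P i, {u : V | G.Adj v u ∧ ∃ j : Fin t, i ≤ j ∧ u ∈ P j}.ncard ≤ s)

/-- `Reach G f g n`: `g` is obtained from `f` by single-vertex recolorings through proper
colorings, in which each vertex `v` is recolored at most `n v` times. -/
inductive Reach {V : Type} [DecidableEq V] {k : ℕ} (G : SimpleGraph V) (f : V → Fin k) :
    (V → Fin k) → (V → ℕ) → Prop
  | refl (n : V → ℕ) (hf : ProperColoring G k f) : Reach G f f n
  | step (g : V → Fin k) (n : V → ℕ) (v : V) (x : Fin k) (hg : Reach G f g n) (hx : x ≠ g v)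
      (hp : ProperColoring G k (Function.update g v x)) :
      Reach G f (Function.update g v x) (n + Pi.single v 1)

/-- The neighbors of `v` of level at least that of `v` whose color lies in `K`. -/
def laterNeighbors {V : Type} {k : ℕ} (G : SimpleGraph V) (l : V → ℕ) (K : Finset (Fin k))
    (f : V → Fin k) (v : V) : Set V :=
  {u | G.Adj v u ∧ l v ≤ l u ∧ f u ∈ K}

/-- Every vertex of level below `b` with a color in `K` has at most `r` later neighbors with a
color in `K`. -/
def LaterDegreeLE {V : Type} {k : ℕ} (G : SimpleGraph V) (l : V → ℕ) (K : Finset (Fin k))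
    (r b : ℕ) (f : V → Fin k) : Prop :=
  ∀ v, l v < b → f v ∈ K → (laterNeighbors G l K f v).ncard ≤ r

/-- `g` differs from `f` only at vertices whose colors under `f` and `g` both lie in `K`. -/
def RecolorsWithin {V : Type} {k : ℕ} (K : Finset (Fin k)) (f g : V → Fin k) : Prop :=
  ∀ v, g v = f v ∨ (f v ∈ K ∧ g v ∈ K)

/-- Any color of a set `K` of `r + 2` colors can be eliminated from the levels below `b`, where
`b ≤ t`, by recoloring only vertices of these levels, each at most `n` times. -/
def ColorRemovable {V : Type} [DecidableEq V] (k : ℕ) (G : SimpleGraph V) (l : V → ℕ)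
    (r t n : ℕ) : Prop :=
  ∀ (K : Finset (Fin k)), K.card = r + 2 → ∀ top ∈ K, ∀ b ≤ t, ∀ f : V → Fin k,
    ProperColoring G k f → LaterDegreeLE G l K r b f →
    ∃ g, Reach G f g (fun v => if l v < b then n else 0) ∧ RecolorsWithin K f g ∧
      ∀ v, l v < b → g v ≠ top

section

variable {V : Type} {k : ℕ} {G : SimpleGraph V} {f g h : V → Fin k} {l : V → ℕ}
  {K K' : Finset (Fin k)}

lemma RecolorsWithin.mem_iff (hK : RecolorsWithin K f g) (v : V) : g v ∈ K ↔ f v ∈ K := by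
  rcases hK v with hv | hv
  · rw [hv]
  · simp [hv]

lemma RecolorsWithin.mono (hK : RecolorsWithin K f g) (h : K ⊆ K') : RecolorsWithin K' f g :=
  fun v => (hK v).imp_right fun hv => ⟨h hv.1, h hv.2⟩

lemma RecolorsWithin.trans (h₁ : RecolorsWithin K f g) (h₂ : RecolorsWithin K g h) :
    RecolorsWithin K f h := by
  intro v
  rcases h₁ v with hv | hv <;> rcases h₂ v with hv' | hv' <;> grind

lemma recolorsWithin_of_ite {x : Fin k} {I : Finset V} [DecidableEq V] (hx : x ∈ K)
    (hI : ∀ v ∈ I, f v ∈ K) : RecolorsWithin K f fun v => if v ∈ I then x else f v := by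
  intro v
  by_cases hv : v ∈ I
  · exact .inr ⟨hI v hv, by simpa [hv] using hx⟩
  · exact .inl (by simp [hv])

lemma LaterDegreeLE.congr {r b : ℕ} (hd : LaterDegreeLE G l K r b f)
    (hK : RecolorsWithin K f g) : LaterDegreeLE G l K r b g := by
  intro v hv hgv
  have : laterNeighbors G l K g v = laterNeighbors G l K f v := by
    ext u
    simp [laterNeighbors, hK.mem_iff]
  rw [this]
  exact hd v hv ((hK.mem_iff v).1 hgv)

lemma LaterDegreeLE.mono {r b b' : ℕ} (hd : LaterDegreeLE G l K r b f) (hb : b' ≤ b) :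
    LaterDegreeLE G l K r b' f :=
  fun v hv => hd v (hv.trans_le hb)

end

section

variable {V : Type} [DecidableEq V] {k : ℕ} {G : SimpleGraph V} {f g h : V → Fin k}

namespace Reach

lemma proper {n : V → ℕ} (hr : Reach G f g n) : ProperColoring G k g := by
  cases hr <;> assumption

lemma mono {n m : V → ℕ} (hr : Reach G f g n) (hnm : n ≤ m) : Reach G f g m := by
  induction hr generalizing m with
  | refl n hf => exact .refl m hf
  | step g n v x _ hx hp ih =>
    have hm : m = (m - Pi.single v 1) + Pi.single v 1 := by
      ext w
      have := hnm w
      simp only [Pi.add_apply, Pi.sub_apply] at this ⊢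
      omega
    rw [hm]
    refine .step g _ v x (ih fun w => ?_) hx hp
    have := hnm w
    simp only [Pi.add_apply, Pi.sub_apply] at this ⊢
    omega

lemma trans {n m : V → ℕ} (h₁ : Reach G f g n) (h₂ : Reach G g h m) :
    Reach G f h (n + m) := by
  induction h₂ with
  | refl m _ => exact h₁.mono (by simp)
  | step g' m v x _ hx hp ih =>
    rw [← add_assoc]
    exact .step g' _ v x ih hx hp

lemma eq_of_eq_zero {n : V → ℕ} (hr : Reach G f g n) {w : V} (hw : n w = 0) : g w = f w := by
  induction hr with
  | refl => rfl
  | step g n v x _ _ _ ih =>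
    simp only [Pi.add_apply, Nat.add_eq_zero_iff] at hw
    have hwv : w ≠ v := by
      rintro rfl
      simp at hw
    rw [Function.update_of_ne hwv, ih hw.1]

lemma exists_recoloringSeq {n : V → ℕ} (hr : Reach G f g n) :
    ∃ (m : ℕ) (c : ℕ → V → Fin k), c 0 = f ∧ c m = g ∧ RecoloringSeq G k m c ∧
      ∀ v, recolorCount c m v ≤ n v := by
  induction hr with
  | refl n hf =>
    exact ⟨0, fun _ => f, rfl, rfl, ⟨fun _ _ => hf, fun i hi => absurd hi (by omega)⟩,
      fun v => by simp [recolorCount]⟩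
  | step g n v x _ hx hp ih =>
    obtain ⟨m, c, h0, hm, ⟨hc, hd⟩, hn⟩ := ih
    refine ⟨m + 1, fun i => if i ≤ m then c i else Function.update g v x, by simp [h0], by simp,
      ⟨fun i _ => ?_, fun i hi => ?_⟩, fun w => ?_⟩
    · dsimp only
      split_ifs with him
      · exact hc i him
      · exact hp
    · rcases Nat.lt_succ_iff_lt_or_eq.1 hi with him | rfl
      · simpa [him.le, Nat.succ_le_of_lt him] using hd i him
      · refine ⟨v, by simpa [hm] using hx.symm, fun w hw => ?_⟩
        by_contra hwv
        simp [hm, hwv] at hw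
    · rw [recolorCount, Finset.range_add_one, Finset.filter_insert]
      have hcount : ((Finset.range m).filter fun i =>
          (if i ≤ m then c i else Function.update g v x) w ≠
            (if i + 1 ≤ m then c (i + 1) else Function.update g v x) w).card ≤ n w := by
        refine le_trans (le_of_eq ?_) (hn w)
        rw [recolorCount]
        congr 1
        refine Finset.filter_congr fun i hi => ?_
        have := Finset.mem_range.1 hi
        simp [this.le, Nat.succ_le_of_lt this]
      by_cases hwv : w = v
      · subst hwv
        rw [Pi.add_apply, Pi.single_eq_same]
        refine le_trans ?_ (Nat.add_le_add_right hcount 1)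
        by_cases hif : (if m ≤ m then c m else Function.update g w x) w ≠
            (if m + 1 ≤ m then c (m + 1) else Function.update g w x) w
        · rw [if_pos hif]
          exact Finset.card_insert_le _ _
        · rw [if_neg hif]
          exact Nat.le_succ _
      · rw [if_neg (by simp [hm, hwv])]
        exact hcount.trans (by simp)

end Reach

/-- Recoloring all vertices of a set with one color, when the result is proper. -/
lemma reach_recolor_finset (hf : ProperColoring G k f) (I : Finset V) (x : Fin k)
    (hI : ProperColoring G k fun v => if v ∈ I then x else f v) :
    Reach G f (fun v => if v ∈ I then x else f v) (fun v => if v ∈ I then 1 else 0) := by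
  induction I using Finset.induction_on with
  | empty => simpa using Reach.refl _ hf
  | insert a I ha ih =>
    have hproper : ProperColoring G k fun v => if v ∈ I then x else f v := by
      intro u v huv
      have h₁ := hI huv
      have h₂ := hf huv
      simp only [Finset.mem_insert] at h₁ ⊢
      grind
    have hreach := ih hproper
    have hupd : (fun v => if v ∈ insert a I then x else f v) =
        Function.update (fun v => if v ∈ I then x else f v) a x := by
      ext v
      by_cases hv : v = a <;> simp [hv]
    have hcost : (fun v => if v ∈ insert a I then 1 else 0) =
        (fun v => if v ∈ I then 1 else 0) + Pi.single a 1 := by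
      ext v
      by_cases hv : v = a
      · subst hv
        simp [ha]
      · simp [hv]
    by_cases hx : x = f a
    · have hsame : (fun v => if v ∈ insert a I then x else f v) =
          fun v => if v ∈ I then x else f v := by
        ext v
        by_cases hv : v = a
        · subst hv
          simp [hx]
        · simp [hv]
      rw [hsame, hcost]
      exact hreach.mono (by simp)
    · rw [hupd] at hI ⊢
      rw [hcost]
      exact .step _ _ a x hreach (by simpa [ha] using hx) hI

/-- The greedy independent subset of `E`, built from the highest level down. -/
lemma exists_greedy_independent (G : SimpleGraph V) (l : V → ℕ) (E : Finset V) :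
    ∃ I ⊆ E, (∀ u ∈ I, ∀ v ∈ I, ¬ G.Adj u v) ∧
      ∀ v ∈ E, v ∉ I → ∃ u ∈ I, G.Adj v u ∧ l v ≤ l u := by
  induction E using Finset.induction_on_min_value l with
  | empty => exact ⟨∅, by simp⟩
  | insert a E ha hmin ih =>
    obtain ⟨I, hIE, hind, hdom⟩ := ih
    by_cases hadj : ∃ u ∈ I, G.Adj a u
    · obtain ⟨u, hu, hau⟩ := hadj
      refine ⟨I, hIE.trans (Finset.subset_insert _ _), hind, fun v hv hvI => ?_⟩
      rcases Finset.mem_insert.1 hv with rfl | hv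
      · exact ⟨u, hu, hau, hmin u (hIE hu)⟩
      · exact hdom v hv hvI
    · push Not at hadj
      refine ⟨insert a I, Finset.insert_subset_insert _ hIE, fun u hu v hv => ?_,
        fun v hv hvI => ?_⟩
      · rcases Finset.mem_insert.1 hu with rfl | hu' <;>
          rcases Finset.mem_insert.1 hv with rfl | hv'
        · exact G.irrefl
        · exact hadj v hv'
        · exact fun h => hadj u hu' h.symm
        · exact hind u hu' v hv'
      · rw [Finset.mem_insert, not_or] at hvI
        obtain ⟨u, hu, huv⟩ := hdom v (Finset.mem_of_mem_insert_of_ne hv hvI.1) hvI.2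
        exact ⟨u, Finset.mem_insert_of_mem hu, huv⟩

variable [Fintype V] {l : V → ℕ} {K : Finset (Fin k)}

/-- If the color `x` is absent below level `b`, it can be used to eliminate the color `y`. -/
lemma ColorRemovable.exchange {r t n b : ℕ} (hT : ColorRemovable k G l r t n) (hb : b ≤ t)
    (hcard : K.card = r + 3) {x y : Fin k} (hx : x ∈ K) (hy : y ∈ K) (hxy : x ≠ y)
    (hf : ProperColoring G k f) (hd : LaterDegreeLE G l K (r + 1) b f)
    (hfx : ∀ v, l v < b → f v ≠ x) :
    ∃ g, Reach G f g (fun v => if l v < b then n + 1 else 0) ∧ RecolorsWithin K f g ∧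
      ∀ v, l v < b → g v ≠ y := by
  classical
  obtain ⟨I, hIE, hind, hdom⟩ := exists_greedy_independent G l
    (Finset.univ.filter fun v => l v < b ∧ f v ∈ K ∧ ∀ u, G.Adj v u → f u ≠ x)
  have hI : ∀ v ∈ I, l v < b ∧ f v ∈ K ∧ ∀ u, G.Adj v u → f u ≠ x := fun v hv => by
    simpa using hIE hv
  set f' : V → Fin k := fun v => if v ∈ I then x else f v with hf'
  have hproper : ProperColoring G k f' := by
    intro u v huv
    simp only [hf']
    split_ifs with hu hv hv
    · exact absurd huv (hind u hu v hv)
    · exact ((hI u hu).2.2 v huv).symm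
    · exact (hI v hv).2.2 u huv.symm
    · exact hf huv
  have hf'K : RecolorsWithin K f f' := recolorsWithin_of_ite hx fun v hv => (hI v hv).2.1
  have hd' : LaterDegreeLE G l (K.erase x) r b f' := by
    intro v hv hfv
    rw [Finset.mem_erase] at hfv
    have hvI : v ∉ I := fun hvI => hfv.1 (by simp [hf', hvI])
    have hvK := (hf'K.mem_iff v).1 hfv.2
    obtain ⟨u, huv, hlu, hux⟩ : ∃ u, G.Adj v u ∧ l v ≤ l u ∧ f' u = x := by
      by_cases hE : ∀ u, G.Adj v u → f u ≠ x
      · obtain ⟨u, hu, huv, hlu⟩ := hdom v (by simpa [hv, hvK] using hE) hvI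
        exact ⟨u, huv, hlu, by simp [hf', hu]⟩
      · push Not at hE
        obtain ⟨u, huv, hux⟩ := hE
        refine ⟨u, huv, ?_, by simp [hf', hux]⟩
        by_contra hlt
        exact hfx u (by omega) hux
    have hlt : (laterNeighbors G l (K.erase x) f' v).ncard < (laterNeighbors G l K f v).ncard := by
      refine Set.ncard_lt_ncard ?_ (Set.toFinite _)
      refine ⟨fun w hw => ⟨hw.1, hw.2.1, (hf'K.mem_iff w).1 (Finset.mem_of_mem_erase hw.2.2)⟩,
        fun hsub => ?_⟩
      have := hsub (show u ∈ laterNeighbors G l K f v from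
        ⟨huv, hlu, (hf'K.mem_iff u).1 (hux ▸ hx)⟩)
      exact (Finset.mem_erase.1 this.2.2).1 hux
    have := hd v hv hvK
    omega
  obtain ⟨g, hg, hgK, hgy⟩ := hT (K.erase x) (by rw [Finset.card_erase_of_mem hx]; omega) y
    (Finset.mem_erase.2 ⟨hxy.symm, hy⟩) b hb f' hproper hd'
  refine ⟨g, ((reach_recolor_finset hf I x hproper).trans hg).mono fun v => ?_,
    hf'K.trans (hgK.mono (Finset.erase_subset _ _)), hgy⟩
  simp only [Pi.add_apply]
  by_cases hv : v ∈ I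
  · simp [hv, (hI v hv).1, add_comm]
  · by_cases hlv : l v < b <;> simp [hv, hlv]

/-- If the color `top` is absent below level `d`, then vertices of level `d` colored `top` without
later neighbors of color `a` can be recolored to `a`, leaving no vertex below level `d` colored
`top`. -/
lemma ColorRemovable.recolor_finset {r t n d : ℕ} (hT : ColorRemovable k G l r t n) (hd : d ≤ t)
    (hcard : K.card = r + 3) {top a : Fin k} (htop : top ∈ K) (ha : a ∈ K) (hne : top ≠ a)
    (hf : ProperColoring G k f) (hdeg : LaterDegreeLE G l K (r + 1) d f)
    (hftop : ∀ v, l v < d → f v ≠ top) (S : Finset V)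
    (hS : ∀ v ∈ S, l v = d ∧ f v = top ∧ ∀ u, G.Adj v u → d ≤ l u → f u ≠ a) :
    ∃ g, Reach G f g (fun v => if l v < d then 2 * (n + 1) else if v ∈ S then 1 else 0) ∧
      RecolorsWithin K f g ∧ (∀ v, l v < d → g v ≠ top) ∧
      ∀ v, d ≤ l v → g v = if v ∈ S then a else f v := by
  obtain ⟨g₁, hg₁, hK₁, ha₁⟩ := hT.exchange hd hcard htop ha hne hf hdeg hftop
  have heq₁ : ∀ v, d ≤ l v → g₁ v = f v := fun v hv =>
    hg₁.eq_of_eq_zero (by simp [hv.not_gt])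
  set g₂ : V → Fin k := fun v => if v ∈ S then a else g₁ v with hg₂
  have hSa : ∀ v ∈ S, ∀ u, G.Adj v u → g₁ u ≠ a := by
    intro v hv u huv
    by_cases hu : l u < d
    · exact ha₁ u hu
    · rw [heq₁ u (by omega)]
      exact (hS v hv).2.2 u huv (by omega)
  have hproper : ProperColoring G k g₂ := by
    intro u v huv
    simp only [hg₂]
    split_ifs with hu hv hv
    · exact absurd ((hS u hu).2.1.trans (hS v hv).2.1.symm) (hf huv)
    · exact (hSa u hu v huv).symm
    · exact hSa v hv u huv.symm
    · exact hg₁.proper huv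
  have hK₂ : RecolorsWithin K g₁ g₂ := recolorsWithin_of_ite ha fun v hv => by
    rw [heq₁ v (hS v hv).1.ge, (hS v hv).2.1]
    exact htop
  have ha₂ : ∀ v, l v < d → g₂ v ≠ a := by
    intro v hv
    have : v ∉ S := fun hvS => by
      have := (hS v hvS).1
      omega
    simpa [hg₂, this] using ha₁ v hv
  obtain ⟨g₃, hg₃, hK₃, htop₃⟩ := hT.exchange hd hcard ha htop hne.symm hproper
    (hdeg.congr (hK₁.trans hK₂)) ha₂
  refine ⟨g₃, ((hg₁.trans (reach_recolor_finset hg₁.proper S a hproper)).trans hg₃).mono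
    fun v => ?_, (hK₁.trans hK₂).trans hK₃, htop₃, fun v hv => ?_⟩
  · simp only [Pi.add_apply]
    by_cases hv : l v < d
    · have : v ∉ S := fun hvS => by
        have := (hS v hvS).1
        omega
      simp only [hv, this, if_true, if_false]
      omega
    · simp [hv]
  · rw [hg₃.eq_of_eq_zero (by simp [hv.not_gt])]
    simp only [hg₂, heq₁ v hv]

lemma ColorRemovable.recolor_of_mem {r t n d : ℕ} (hT : ColorRemovable k G l r t n) (hd : d ≤ t)
    (hcard : K.card = r + 3) {top : Fin k} (htop : top ∈ K)
    (hf : ProperColoring G k f) (hdeg : LaterDegreeLE G l K (r + 1) d f)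
    (hftop : ∀ v, l v < d → f v ≠ top) (A : Finset (Fin k)) (hA : A ⊆ K.erase top)
    (S : Finset V) (hS : ∀ v ∈ S, l v = d ∧ f v = top ∧
      ∃ a ∈ A, ∀ u, G.Adj v u → d ≤ l u → f u ≠ a) :
    ∃ g, Reach G f g
        (fun v => if l v < d then A.card * (2 * (n + 1)) else if v ∈ S then 1 else 0) ∧
      RecolorsWithin K f g ∧ (∀ v, l v < d → g v ≠ top) ∧ ∀ v ∈ S, g v ≠ top := by
  classical
  induction A using Finset.induction_on generalizing S with
  | empty =>
    exact ⟨f, .refl _ hf, fun v => .inl rfl, hftop, fun v hv => by simpa using (hS v hv).2.2⟩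
  | insert a A ha ih =>
    obtain ⟨g₁, hg₁, hK₁, htop₁, hS₁⟩ := ih ((Finset.subset_insert _ _).trans hA)
      (S.filter fun v => ∃ a ∈ A, ∀ u, G.Adj v u → d ≤ l u → f u ≠ a)
      (fun v hv => by
        rw [Finset.mem_filter] at hv
        exact ⟨(hS v hv.1).1, (hS v hv.1).2.1, hv.2⟩)
    set S₁ := S.filter fun v => ∃ a ∈ A, ∀ u, G.Adj v u → d ≤ l u → f u ≠ a with hS₁def
    have hS₁S : ∀ v ∈ S₁, v ∈ S := fun v hv => (Finset.mem_filter.1 hv).1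
    have heq : ∀ v, d ≤ l v → v ∉ S₁ → g₁ v = f v := fun v hv hvS =>
      hg₁.eq_of_eq_zero (by simp [hv.not_gt, hvS])
    have haK := Finset.mem_erase.1 (hA (Finset.mem_insert_self a A))
    obtain ⟨g₂, hg₂, hK₂, htop₂, hS₂⟩ := hT.recolor_finset hd hcard htop haK.2 haK.1.symm
      hg₁.proper (hdeg.congr hK₁) htop₁ (S \ S₁) (fun v hv => by
        rw [Finset.mem_sdiff] at hv
        obtain ⟨hlv, hfv, c, hc, hcv⟩ := hS v hv.1
        refine ⟨hlv, by rw [heq v hlv.ge hv.2, hfv], fun u huv hlu => ?_⟩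
        have hca : c = a := by
          refine (Finset.mem_insert.1 hc).resolve_right fun hcA => hv.2 ?_
          rw [hS₁def, Finset.mem_filter]
          exact ⟨hv.1, c, hcA, hcv⟩
        have huS : u ∉ S₁ := fun hu => hf huv (hfv.trans (hS u (hS₁S u hu)).2.1.symm)
        rw [heq u hlu huS, ← hca]
        exact hcv u huv hlu)
    refine ⟨g₂, (hg₁.trans hg₂).mono fun v => ?_, hK₁.trans hK₂, htop₂, fun v hv => ?_⟩
    · simp only [Pi.add_apply, Finset.card_insert_of_notMem ha]
      by_cases hv : l v < d
      · simp only [hv, if_true]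
        exact le_of_eq (by ring)
      · by_cases hv₁ : v ∈ S₁
        · simp [hv, hv₁, hS₁S v hv₁]
        · simp [hv, hv₁]
    · rw [hS₂ v (hS v hv).1.ge]
      by_cases hv₁ : v ∈ S₁
      · simpa [hv₁] using hS₁ v hv₁
      · simpa [hv₁, hv] using haK.1

/-- If the color `top` is absent below level `d`, it can be removed from any set of vertices of
level `d`, recoloring each of these at most once. -/
lemma ColorRemovable.remove_from_level {r t n d : ℕ} (hT : ColorRemovable k G l r t n)
    (hd : d ≤ t) (hcard : K.card = r + 3) {top : Fin k} (htop : top ∈ K)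
    (hf : ProperColoring G k f) (hdeg : LaterDegreeLE G l K (r + 1) (d + 1) f)
    (hftop : ∀ v, l v < d → f v ≠ top) (S : Finset V) (hS : ∀ v ∈ S, l v = d ∧ f v = top) :
    ∃ g, Reach G f g
        (fun v => if l v < d then (r + 2) * (2 * (n + 1)) else if v ∈ S then 1 else 0) ∧
      RecolorsWithin K f g ∧ (∀ v, l v < d → g v ≠ top) ∧ ∀ v ∈ S, g v ≠ top := by
  have hAcard : (K.erase top).card = r + 2 := by
    rw [Finset.card_erase_of_mem htop]
    omega
  rw [← hAcard]
  refine hT.recolor_of_mem hd hcard htop hf (hdeg.mono d.le_succ) hftop _ subset_rfl S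
    fun v hv => ⟨(hS v hv).1, (hS v hv).2, ?_⟩
  obtain ⟨hlv, hfv⟩ := hS v hv
  by_contra! hcon
  have hsub : ((K.erase top : Finset (Fin k)) : Set (Fin k)) ⊆ f '' laterNeighbors G l K f v := by
    intro a ha
    obtain ⟨u, huv, hlu, hua⟩ := hcon a ha
    exact ⟨u, ⟨huv, hlv.trans_le hlu, hua ▸ Finset.mem_of_mem_erase ha⟩, hua⟩
  have h₁ := Set.ncard_le_ncard hsub (Set.toFinite _)
  have h₂ := Set.ncard_image_le (f := f) (Set.toFinite (laterNeighbors G l K f v))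
  have h₃ := hdeg v (by omega) (hfv ▸ htop)
  rw [Set.ncard_coe_finset, hAcard] at h₁
  omega

lemma colorRemovable_zero (G : SimpleGraph V) (l : V → ℕ) (t : ℕ) :
    ColorRemovable k G l 0 t 1 := by
  intro K hK top htop b _ f hf hd
  obtain ⟨y, hyK, hy⟩ := K.exists_mem_ne (by omega) top
  set I := Finset.univ.filter fun v => l v < b ∧ f v = top with hIdef
  have hI : ∀ v ∈ I, l v < b ∧ f v = top := fun v hv => by simpa [hIdef] using hv
  have hlater : ∀ u v, l v < b → f v ∈ K → f u ∈ K → l v ≤ l u → ¬ G.Adj v u := by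
    intro u v hv hvK huK hle huv
    have h0 := (Set.ncard_eq_zero (Set.toFinite _)).1 (Nat.le_zero.1 (hd v hv hvK))
    exact Set.notMem_empty u (h0 ▸ (show u ∈ laterNeighbors G l K f v from ⟨huv, hle, huK⟩))
  have hIy : ∀ v ∈ I, ∀ u, G.Adj v u → f u ≠ y := by
    intro v hv u huv huy
    obtain ⟨hlv, hfv⟩ := hI v hv
    rcases le_total (l v) (l u) with hle | hle
    · exact hlater u v hlv (hfv ▸ htop) (huy ▸ hyK) hle huv
    · exact hlater v u (hle.trans_lt hlv) (huy ▸ hyK) (hfv ▸ htop) hle huv.symm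
  refine ⟨_, (reach_recolor_finset hf I y ?_).mono fun v => ?_, recolorsWithin_of_ite hyK
    fun v hv => (hI v hv).2 ▸ htop, fun v hv => ?_⟩
  · intro u v huv
    dsimp only
    split_ifs with hu hv hv
    · exact absurd ((hI u hu).2.trans (hI v hv).2.symm) (hf huv)
    · exact (hIy u hu v huv).symm
    · exact hIy v hv u huv.symm
    · exact hf huv
  · by_cases hv : v ∈ I
    · simp [hv, (hI v hv).1]
    · simp [hv]
  · split_ifs with h₁
    · exact hy
    · simpa [hIdef, hv] using h₁

lemma ColorRemovable.succ {r t n : ℕ} (hT : ColorRemovable k G l r t n) :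
    ColorRemovable k G l (r + 1) t (t * ((r + 2) * (2 * (n + 1)))) := by
  intro K hK top htop b hb f hf hd
  suffices ∃ g, Reach G f g (fun v => if l v < b then b * ((r + 2) * (2 * (n + 1))) else 0) ∧
      RecolorsWithin K f g ∧ ∀ v, l v < b → g v ≠ top by
    obtain ⟨g, hg, hg'⟩ := this
    refine ⟨g, hg.mono fun v => ?_, hg'⟩
    dsimp only
    split_ifs
    · exact Nat.mul_le_mul_right _ hb
    · rfl
  induction b with
  | zero => exact ⟨f, .refl _ hf, fun v => .inl rfl, by simp⟩
  | succ d ih =>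
    obtain ⟨g₁, hg₁, hK₁, htop₁⟩ := ih (by omega) (hd.mono d.le_succ)
    set S := Finset.univ.filter fun v => l v = d ∧ g₁ v = top with hS
    obtain ⟨g₂, hg₂, hK₂, htop₂, hS₂⟩ := hT.remove_from_level (by omega) hK htop hg₁.proper
      (hd.congr hK₁) htop₁ S (fun v hv => by simpa [hS] using hv)
    refine ⟨g₂, (hg₁.trans hg₂).mono fun v => ?_, hK₁.trans hK₂, fun v hv => ?_⟩
    · have hpos : 0 < (r + 2) * (2 * (n + 1)) := by positivity
      simp only [Pi.add_apply]
      by_cases hlt : l v < d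
      · simp only [hlt, hlt.trans d.lt_succ_self, if_true]
        exact le_of_eq (by ring)
      · by_cases hvS : v ∈ S
        · have hlv : l v < d + 1 := by
            have : l v = d ∧ g₁ v = top := by simpa [hS] using hvS
            omega
          simp only [hlt, hvS, hlv, if_true, if_false, add_mul]
          omega
        · simp [hlt, hvS]
    · by_cases hlt : l v < d
      · exact htop₂ v hlt
      · by_cases hvS : v ∈ S
        · exact hS₂ v hvS
        · rw [hg₂.eq_of_eq_zero (by simp [hlt, hvS])]
          have hlv : l v = d := by omega
          simpa [hS, hlv] using hvS

end

/-- For fixed `r`, a color can be removed with `O((2t)^r)` recolorings of each vertex. -/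
lemma exists_colorRemovable (r : ℕ) :
    ∃ c : ℕ, ∀ (V : Type) [Fintype V] [DecidableEq V] (k : ℕ) (G : SimpleGraph V) (l : V → ℕ)
      (t : ℕ), 1 ≤ t → ColorRemovable k G l r t (c * (2 * t) ^ r) := by
  induction r with
  | zero => exact ⟨1, fun V _ _ k G l t _ => by simpa using colorRemovable_zero G l t⟩
  | succ r ih =>
    obtain ⟨c, hc⟩ := ih
    refine ⟨(r + 2) * (c + 1), fun V _ _ k G l t ht K hK top htop b hb f hf hd => ?_⟩
    obtain ⟨g, hg, hg'⟩ := (hc V k G l t ht).succ K hK top htop b hb f hf hd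
    refine ⟨g, hg.mono fun v => ?_, hg'⟩
    dsimp only
    split_ifs
    · have hpow : 1 ≤ (2 * t) ^ r := Nat.one_le_pow _ _ (by omega)
      calc t * ((r + 2) * (2 * (c * (2 * t) ^ r + 1)))
          ≤ t * ((r + 2) * (2 * (c * (2 * t) ^ r + (2 * t) ^ r))) := by gcongr
        _ = (r + 2) * (c + 1) * (2 * t) ^ (r + 1) := by ring
    · rfl

/-- Claim 3 of the paper. With `F` the layered subgraph on the first `b`
parts, `v_N, …, v_1` an ordering of `V(F)` embedded in the partition (encoded by an injective
`e : Fin N → V` with range `V(F)`, where `e i` is the vertex `v_{i+1}`), `h` the smallest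
index whose part contains a vertex colored `s+2` under `α`, `W` the vertices of `V_h` colored
`s+2`, `U = V_1 ∪ ⋯ ∪ V_{h-1}` and, for a color `a ∈ {1, …, s+1}`,
`W_a = {v_i ∈ W : α(v_j) ≠ a for all neighbors v_j of v_i with j > i}`: there is a recoloring
sequence starting from `α` recoloring each vertex of `U` at most `C * (2t)^(s-1)` times (`C`
depending only on `s`), each vertex of `W_a` at most once, no other vertex at all, and whose
final coloring gives no vertex of `U ∪ W_a` the color `s+2`. -/
theorem statement2 (s : ℕ) (hs : 1 ≤ s) :
    ∃ C : ℕ, ∀ (t : ℕ), 1 ≤ t →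
      ∀ (V : Type) [Fintype V] [DecidableEq V] (G : SimpleGraph V)
        (P : Fin t → Set V), IsDegreePartition G s t P →
      ∀ (b : ℕ), 1 ≤ b → b ≤ t →
      ∀ (N : ℕ) (e : Fin N → V), Function.Injective e →
        Set.range e = {v : V | ∃ j : Fin t, (j : ℕ) < b ∧ v ∈ P j} →
        (∀ i j : Fin N, i < j → ∀ p q : Fin t, e i ∈ P p → e j ∈ P q → p ≤ q) →
      ∀ α : V → Fin (s + 2), ProperColoring G (s + 2) α →
      ∀ h : Fin t, (h : ℕ) < b →
        (∃ v ∈ P h, α v = Fin.last (s + 1)) →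
        (∀ i : Fin t, i < h → ∀ v ∈ P i, α v ≠ Fin.last (s + 1)) →
      ∀ a : Fin (s + 2), a ≠ Fin.last (s + 1) →
      ∀ U W Wa : Set V,
        U = {v : V | ∃ i : Fin t, i < h ∧ v ∈ P i} →
        W = {v : V | v ∈ P h ∧ α v = Fin.last (s + 1)} →
        Wa = {v : V | v ∈ W ∧ ∀ i j : Fin N, e i = v → i < j →
                G.Adj v (e j) → α (e j) ≠ a} →
        ∃ (m : ℕ) (c : ℕ → V → Fin (s + 2)),
          c 0 = α ∧ RecoloringSeq G (s + 2) m c ∧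
          (∀ v ∈ U, recolorCount c m v ≤ C * (2 * t) ^ (s - 1)) ∧
          (∀ v ∈ Wa, recolorCount c m v ≤ 1) ∧
          (∀ v : V, v ∉ U ∪ Wa → recolorCount c m v = 0) ∧
          (∀ v ∈ U ∪ Wa, c m v ≠ Fin.last (s + 1)) := by
  classical
  obtain ⟨r, rfl⟩ : ∃ r, s = r + 1 := ⟨s - 1, by omega⟩
  obtain ⟨c, hc⟩ := exists_colorRemovable r
  refine ⟨(r + 2) * (2 * (c + 1)), ?_⟩
  rintro t ht V _ _ G P ⟨hpart, -, hdeg⟩ b - - N e - - - α hα h - - hmin a - U W Wa rfl rfl rfl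
  choose p hp using fun v => (hpart v).exists
  have hpeq : ∀ {v i}, v ∈ P i → p v = i := fun {v i} hv => (hpart v).unique (hp v) hv
  have hlater : LaterDegreeLE G (fun v => (p v : ℕ)) Finset.univ (r + 1) (h + 1) α := by
    intro v _ _
    refine le_trans (Set.ncard_le_ncard (fun u hu => ?_) (Set.toFinite _)) (hdeg (p v) v (hp v))
    exact ⟨hu.1, p u, hu.2.1, hp u⟩
  have hU : ∀ v, (p v : ℕ) < h ↔ v ∈ {v : V | ∃ i : Fin t, i < h ∧ v ∈ P i} := fun v =>
    ⟨fun hv => ⟨p v, hv, hp v⟩, fun ⟨i, hi, hvi⟩ => by rwa [hpeq hvi]⟩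
  set Wa := {v : V | v ∈ {v : V | v ∈ P h ∧ α v = Fin.last (r + 1 + 1)} ∧
    ∀ i j : Fin N, e i = v → i < j → G.Adj v (e j) → α (e j) ≠ a}
  have hWa : ∀ v ∈ Wa, (p v : ℕ) = h ∧ α v = Fin.last (r + 1 + 1) := fun v hv =>
    ⟨by rw [hpeq hv.1.1], hv.1.2⟩
  obtain ⟨g, hg, -, hgU, hgWa⟩ := (hc V (r + 1 + 2) G (fun v => (p v : ℕ)) t ht).remove_from_level
    (d := h) h.2.le (by simp) (Finset.mem_univ _) hα hlater
    (fun v hv => hmin (p v) hv v (hp v)) (Finset.univ.filter (· ∈ Wa))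
    (fun v hv => hWa v (by simpa using hv))
  obtain ⟨m, q, h0, hm, hq, hcount⟩ := hg.exists_recoloringSeq
  refine ⟨m, q, h0, hq, fun v hv => ?_, fun v hv => ?_, fun v hv => ?_, fun v hv => ?_⟩
  · refine (hcount v).trans ?_
    simp only [(hU v).2 hv, if_true, Nat.add_sub_cancel]
    have hpow : 1 ≤ (2 * t) ^ r := Nat.one_le_pow _ _ (by omega)
    calc (r + 2) * (2 * (c * (2 * t) ^ r + 1))
        ≤ (r + 2) * (2 * (c * (2 * t) ^ r + (2 * t) ^ r)) := by gcongr
      _ = (r + 2) * (2 * (c + 1)) * (2 * t) ^ r := by ring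
  · refine (hcount v).trans ?_
    simp [(hWa v hv).1, hv]
  · rw [Set.mem_union, not_or, ← hU] at hv
    refine Nat.le_zero.1 ((hcount v).trans ?_)
    rw [if_neg hv.1, if_neg (by simpa using hv.2)]
  · rw [hm]
    rcases hv with hv | hv
    · exact hgU v ((hU v).2 hv)
    · exact hgWa v (by simpa using hv)
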